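/- For every finite simple graph G, η(G) equals the maximum number of pairwise vertex-disjoint cycles in G; that is, the maximum over all matchings m on F(G) of the number of oriented cycles induced by m equals the maximum cardinality of a collection of pairwise vertex-disjoint cycles in G. -/

import Mathlib

/-- The arc relation of the face poset of a finite abstract simplicial complex `X`
(given as a finite family of finite faces): an arc from `σ` down to `τ` whenever
`τ` is a codimension-one face of `σ`. -/
def FaceArc {V : Type*} (X : Finset (Finset V)) (σ τ : Finset V) : Prop :=
  σ ∈ X ∧ τ ∈ X ∧ τ ⊂ σ ∧ τ.card + 1 = σ.card

/-- The arc relation of the face poset of a simple graph `G`, regarded as a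
1-dimensional simplicial complex: an arc from each edge-face `{u, v}` down to
each of its endpoint vertex-faces. -/
def GraphArc {V : Type*} [DecidableEq V] (G : SimpleGraph V) (σ τ : Finset V) : Prop :=
  ∃ u v : V, G.Adj u v ∧ σ = {u, v} ∧ (τ = {u} ∨ τ = {v})

/-- A matching on the digraph with arc relation `A`: a finite set of arcs,
no two of which share an endpoint. -/
def IsMatching {α : Type*} (A : α → α → Prop) (m : Finset (α × α)) : Prop :=
  (∀ p ∈ m, A p.1 p.2) ∧
    ∀ p ∈ m, ∀ q ∈ m, p ≠ q →
      p.1 ≠ q.1 ∧ p.1 ≠ q.2 ∧ p.2 ≠ q.1 ∧ p.2 ≠ q.2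

/-- The arc relation of the digraph obtained from the digraph with arc relation `A`
by reversing the arcs belonging to `m`. -/
def MStep {α : Type*} (A : α → α → Prop) (m : Finset (α × α)) (a b : α) : Prop :=
  (A a b ∧ (a, b) ∉ m) ∨ (A b a ∧ (b, a) ∈ m)

/-- `IsCycleList R l` says the nonempty list `l` of pairwise distinct vertices is a
directed cycle of the digraph with arc relation `R` (consecutive steps, closing up). -/
def IsCycleList {α : Type*} (R : α → α → Prop) : List α → Prop
  | [] => False
  | a :: l => (a :: l).Nodup ∧ List.Chain R a (l ++ [a])

/-- The set of oriented cycles induced by the matching `m` on the digraph with arc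
relation `A` (as lists of vertices; rotated lists represent the same cycle). -/
def cyclesOf {α : Type*} (A : α → α → Prop) (m : Finset (α × α)) : Set (List α) :=
  {l | IsCycleList (MStep A m) l}

/-- `numCycles A m` is `J(m)`, the number of oriented cycles induced by `m`
(cycle lists counted up to rotation). -/
noncomputable def numCycles {α : Type*} (A : α → α → Prop) (m : Finset (α × α)) : ℕ :=
  (Quotient.mk (List.IsRotated.setoid α) '' cyclesOf A m).ncard

namespace EtaAux

open SimpleGraph

variable {V : Type*} [DecidableEq V] {G : SimpleGraph V}

lemma isCycleList_iff {α : Type*} (R : α → α → Prop) (l : List α) :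
    IsCycleList R l ↔ l ≠ [] ∧ l.Nodup ∧ Cycle.Chain R (l : Cycle α) := by
  cases l with
  | nil => simp [IsCycleList]
  | cons a l => simp [IsCycleList, List.Chain, Cycle.chain_coe_cons]

lemma isCycleList_rotated {α : Type*} {R : α → α → Prop} {l l' : List α}
    (h : l.IsRotated l') (hl : IsCycleList R l) : IsCycleList R l' := by
  rw [isCycleList_iff] at *
  refine ⟨fun h0 => hl.1 ?_, h.nodup_iff.1 hl.2.1, ?_⟩
  · subst h0; simpa using h
  · rw [← Cycle.coe_eq_coe.2 h]; exact hl.2.2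

lemma exists_rotate {α : Type*} {l : List α} {x : α} (h : x ∈ l) :
    ∃ t, l.IsRotated (x :: t) := by
  obtain ⟨s, t, rfl⟩ := List.append_of_mem h
  exact ⟨t ++ s, List.isRotated_append⟩

lemma exists_pred {α : Type*} {R : α → α → Prop} {l : List α} (hl : IsCycleList R l)
    {y : α} (hy : y ∈ l) : ∃ p, R p y := by
  obtain ⟨t, ht⟩ := exists_rotate hy
  have h := isCycleList_rotated ht hl
  rw [isCycleList_iff] at h
  have h2 := (Cycle.chain_ne_nil R h.1).1 h.2.2
  rw [List.isChain_cons_cons] at h2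
  exact ⟨_, h2.1⟩

lemma det_eq {α : Type*} {R : α → α → Prop} {x : α} :
    ∀ (t₁ t₂ : List α) (a : α), (a :: (t₁ ++ [x])).IsChain R → (a :: (t₂ ++ [x])).IsChain R →
      x ∉ t₁ → x ∉ t₂ →
      (∀ y ∈ a :: t₁, ∀ z z', R y z → R y z' → z = z') → t₁ = t₂
  | [], [], _, _, _, _, _, _ => rfl
  | [], b :: t, a, h1, h2, _, hx, hf => by
      simp only [List.nil_append, List.cons_append, List.isChain_cons_cons] at h1 h2
      exact absurd (hf a (by simp) _ _ h1.1 h2.1) (by rintro rfl; simp at hx)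
  | b :: t, [], a, h1, h2, hx, _, hf => by
      simp only [List.nil_append, List.cons_append, List.isChain_cons_cons] at h1 h2
      exact absurd (hf a (by simp) _ _ h2.1 h1.1) (by rintro rfl; simp at hx)
  | b :: t, c :: s, a, h1, h2, hx, hy, hf => by
      simp only [List.cons_append, List.isChain_cons_cons] at h1 h2
      obtain rfl := hf a (by simp) _ _ h1.1 h2.1
      congr 1
      exact det_eq t s b h1.2 h2.2 (fun h => hx (by simp [h])) (fun h => hy (by simp [h]))
        (fun y hy' => hf y (List.mem_cons_of_mem _ hy'))

lemma rotated_of_common {α : Type*} {R : α → α → Prop}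
    (hf : ∀ p y z z', R p y → R y z → R y z' → z = z')
    {l₁ l₂ : List α} (h1 : IsCycleList R l₁) (h2 : IsCycleList R l₂) {x : α}
    (hx1 : x ∈ l₁) (hx2 : x ∈ l₂) : l₁.IsRotated l₂ := by
  obtain ⟨t₁, r1⟩ := exists_rotate hx1
  obtain ⟨t₂, r2⟩ := exists_rotate hx2
  have c1 := isCycleList_rotated r1 h1
  have c2 := isCycleList_rotated r2 h2
  have : t₁ = t₂ := by
    refine det_eq t₁ t₂ x c1.2 c2.2 (List.nodup_cons.1 c1.1).1 (List.nodup_cons.1 c2.1).1 ?_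
    intro y hy z z' hz hz'
    obtain ⟨p, hp⟩ := exists_pred c1 hy
    exact hf p y z z' hp hz hz'
  subst this
  exact r1.trans r2.symm

lemma arc_card {σ τ : Finset V} (h : GraphArc G σ τ) : σ.card = 2 ∧ τ.card = 1 := by
  obtain ⟨u, v, huv, rfl, rfl | rfl⟩ := h <;> simp [Finset.card_pair huv.ne]

lemma arc_form {σ τ : Finset V} (h : GraphArc G σ τ) :
    ∃ a c, G.Adj a c ∧ σ = {a, c} ∧ τ = {a} := by
  obtain ⟨u, v, huv, rfl, rfl | rfl⟩ := h
  · exact ⟨u, v, huv, rfl, rfl⟩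
  · exact ⟨v, u, huv.symm, Finset.pair_comm _ _, rfl⟩

lemma pair_cancel {a b c : V} (h : ({a, b} : Finset V) = {a, c}) (hb : b ≠ a) : b = c := by
  have : b ∈ ({a, c} : Finset V) := h ▸ (by simp)
  simpa [hb] using this

variable {m : Finset (Finset V × Finset V)}

lemma step_single {a : V} {e : Finset V} (h : MStep (GraphArc G) m {a} e) :
    ∃ c, G.Adj a c ∧ e = {a, c} ∧ (e, {a}) ∈ m := by
  rcases h with ⟨h, _⟩ | ⟨h, h'⟩
  · have := (arc_card h).1; simp at this
  · obtain ⟨a', c, hac, rfl, h2⟩ := arc_form h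
    obtain rfl := Finset.singleton_injective h2
    exact ⟨c, hac, rfl, h'⟩

lemma step_pair {a c : V} {z : Finset V} (hac : G.Adj a c) (hm : (({a, c} : Finset V), {a}) ∈ m)
    (h : MStep (GraphArc G) m {a, c} z) : z = {c} := by
  rcases h with ⟨h, h'⟩ | ⟨h, h'⟩
  · obtain ⟨a', c', _, h1, rfl⟩ := arc_form h
    have : a' ∈ ({a, c} : Finset V) := h1 ▸ (by simp)
    simp only [Finset.mem_insert, Finset.mem_singleton] at this
    rcases this with rfl | rfl
    · exact absurd hm h'
    · rfl
  · have := (arc_card h).2; simp [Finset.card_pair hac.ne] at this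

lemma step_det (hm : IsMatching (GraphArc G) m) (p y z z' : Finset V)
    (hp : MStep (GraphArc G) m p y) (hz : MStep (GraphArc G) m y z)
    (hz' : MStep (GraphArc G) m y z') : z = z' := by
  have hz0 := hz
  rcases hz with ⟨h, h'⟩ | ⟨h, h'⟩
  · rcases hp with ⟨q, _⟩ | ⟨q, q'⟩
    · have := (arc_card q).2; have := (arc_card h).1; omega
    · obtain ⟨a, c, hac, rfl, rfl⟩ := arc_form q
      rw [step_pair hac q' hz0, step_pair hac q' hz']
  · obtain ⟨a, c, hac, rfl, rfl⟩ := arc_form h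
    obtain ⟨d, had, rfl, hd⟩ := step_single hz'
    by_contra hne
    exact (hm.2 _ h' _ hd (fun h => hne (congrArg Prod.fst h))).2.2.2 rfl

/-- The list of faces traversed by a walk, without the last vertex. -/
def expand {a b : V} (w : G.Walk a b) : List (Finset V) :=
  w.darts.flatMap fun d => [{d.fst}, {d.fst, d.snd}]

lemma walk_of_chain : ∀ (L : List (Finset V)) (a b : V),
    (L ++ [{b}]).head? = some {a} → (L ++ [{b}]).IsChain (MStep (GraphArc G) m) →
    ∃ w : G.Walk a b, expand w = L
  | [], a, b, h, _ => by
      simp only [List.nil_append, List.head?_cons, Option.some.injEq] at h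
      obtain rfl := Finset.singleton_injective h
      exact ⟨Walk.nil, rfl⟩
  | [x], a, b, h, hc => by
      simp only [List.cons_append, List.head?_cons, Option.some.injEq] at h
      subst h
      simp only [List.nil_append, List.cons_append, List.isChain_cons_cons] at hc
      obtain ⟨c, hac, h1, _⟩ := step_single hc.1
      have := congrArg Finset.card h1
      simp [Finset.card_pair hac.ne] at this
  | x :: e :: L, a, b, h, hc => by
      simp only [List.cons_append, List.head?_cons, Option.some.injEq] at h
      subst h
      simp only [List.cons_append, List.isChain_cons_cons] at hc
      obtain ⟨h1, h2⟩ := hc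
      obtain ⟨c, hac, rfl, hm⟩ := step_single h1
      have key : (L ++ [{b}]).head? = some {c} ∧
          (L ++ [{b}]).IsChain (MStep (GraphArc G) m) := by
        cases L with
        | nil =>
          simp only [List.nil_append, List.isChain_cons_cons] at h2 ⊢
          exact ⟨by rw [step_pair hac hm h2.1]; rfl, h2.2⟩
        | cons z L =>
          simp only [List.cons_append, List.isChain_cons_cons] at h2 ⊢
          exact ⟨by rw [step_pair hac hm h2.1]; rfl, h2.2⟩
      obtain ⟨w, hw⟩ := walk_of_chain L c b key.1 key.2
      exact ⟨Walk.cons hac w, by simpa [expand] using hw⟩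

lemma singleton_mem_expand {a b : V} (w : G.Walk a b) (x : V) :
    {x} ∈ expand w ↔ x ∈ w.darts.map (·.fst) := by
  simp only [expand, List.mem_flatMap, List.mem_map, List.mem_cons, List.not_mem_nil, or_false,
    Finset.singleton_inj]
  constructor
  · rintro ⟨d, hd, rfl | h⟩
    · exact ⟨d, hd, rfl⟩
    · have := congrArg Finset.card h
      simp [Finset.card_pair d.adj.ne] at this
  · rintro ⟨d, hd, rfl⟩
    exact ⟨d, hd, Or.inl rfl⟩

lemma tail_perm {a : V} (w : G.Walk a a) : 
    (w.darts.map (·.fst)).Perm w.support.tail := by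
  have h : (w.darts.map (·.fst) ++ [a]) = a :: w.support.tail := by
    rw [Walk.map_fst_darts_append]; exact w.support_eq_cons
  have : (a :: w.darts.map (·.fst)).Perm (a :: w.support.tail) := by
    rw [← h]; exact (List.perm_append_singleton _ _).symm
  exact this.cons_inv

lemma mem_support_iff' {a : V} (w : G.Walk a a) (hw : w ≠ Walk.nil) (x : V) :
    x ∈ w.support ↔ x ∈ w.darts.map (·.fst) := by
  rw [(tail_perm w).mem_iff, Walk.mem_support_iff]
  constructor
  · rintro (rfl | h)
    · cases w with
      | nil => exact absurd rfl hw
      | cons h p => simp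
    · exact h
  · exact Or.inr

lemma pair_eq_iff {d d' : G.Dart} :
    ({d.fst, d.snd} : Finset V) = {d'.fst, d'.snd} ↔ d.edge = d'.edge := by
  have h1 : d.edge = s(d.fst, d.snd) := rfl
  have h2 : d'.edge = s(d'.fst, d'.snd) := rfl
  rw [h1, h2, Finset.ext_iff, Sym2.ext_iff]
  simp

lemma pair_ne_single (d : G.Dart) (x : V) : ({d.fst, d.snd} : Finset V) ≠ {x} := by
  intro h
  have := congrArg Finset.card h
  simp [Finset.card_pair d.adj.ne] at this

lemma cycle_of_expand_nodup {a : V} (w : G.Walk a a) (hw : w ≠ Walk.nil)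
    (h : (expand w).Nodup) : w.IsCycle := by
  rw [expand, List.nodup_flatMap] at h
  have h2 := h.2
  rw [Walk.isCycle_def, Walk.isTrail_def]
  refine ⟨?_, hw, ?_⟩
  · unfold Walk.edges
    rw [List.Nodup, List.pairwise_map]
    refine h2.imp ?_
    intro d d' hd he
    exact List.disjoint_left.1 hd (show ({d.fst, d.snd} : Finset V) ∈ _ by simp)
      (by rw [pair_eq_iff.2 he]; simp)
  · rw [← (tail_perm w).nodup_iff, List.Nodup, List.pairwise_map]
    refine h2.imp ?_
    intro d d' hd he
    exact List.disjoint_left.1 hd (show ({d.fst} : Finset V) ∈ _ by simp) (by rw [he]; simp)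

lemma cycle_edge_inj {a : V} {w : G.Walk a a} (hw : w.IsCycle) {d d' : G.Dart}
    (hd : d ∈ w.darts) (hd' : d' ∈ w.darts)
    (h : ({d.fst, d.snd} : Finset V) = {d'.fst, d'.snd}) : d = d' :=
  List.inj_on_of_nodup_map hw.edges_nodup hd hd' (pair_eq_iff.1 h)

lemma cycle_fst_inj {a : V} {w : G.Walk a a} (hw : w.IsCycle) {d d' : G.Dart}
    (hd : d ∈ w.darts) (hd' : d' ∈ w.darts) (h : d.fst = d'.fst) : d = d' :=
  List.inj_on_of_nodup_map ((tail_perm w).nodup_iff.2 hw.support_nodup) hd hd' h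

lemma expand_nodup_of_cycle {a : V} {w : G.Walk a a} (hw : w.IsCycle) : (expand w).Nodup := by
  rw [expand, List.nodup_flatMap]
  refine ⟨fun d _ => by simpa using (pair_ne_single d d.fst).symm, ?_⟩
  have hnd : w.darts.Nodup := List.Nodup.of_map _ hw.edges_nodup
  refine hnd.pairwise_of_forall_ne ?_
  intro d hd d' hd' hne
  simp only [Function.onFun, List.disjoint_left, List.mem_cons, List.not_mem_nil, or_false]
  rintro x (rfl | rfl) (h | h)
  · exact hne (cycle_fst_inj hw hd hd' (Finset.singleton_injective h))
  · exact pair_ne_single _ _ h.symm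
  · exact pair_ne_single _ _ h
  · exact hne (cycle_edge_inj hw hd hd' h)

lemma expand_chain (hm : IsMatching (GraphArc G) m) : ∀ {a b : V} (w : G.Walk a b),
    (∀ d ∈ w.darts, (({d.fst, d.snd} : Finset V), {d.fst}) ∈ m) →
    (expand w ++ [{b}]).head? = some {a} ∧
    (expand w ++ [{b}]).IsChain (MStep (GraphArc G) m)
  | a, _, .nil, _ => by simp [expand]
  | a, b, .cons (v := c) h p, hw => by
      obtain ⟨ih1, ih2⟩ := expand_chain hm p (fun d hd => hw d (by simp [hd]))
      have hd := hw ⟨(a, c), h⟩ (by simp)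
      simp only at hd
      have he : expand (Walk.cons h p) = {a} :: {a, c} :: expand p := by simp [expand]
      rw [he]
      refine ⟨rfl, ?_⟩
      have s1 : MStep (GraphArc G) m {a} {a, c} := Or.inr ⟨⟨a, c, h, rfl, Or.inl rfl⟩, hd⟩
      have s2 : MStep (GraphArc G) m {a, c} {c} := by
        refine Or.inl ⟨⟨a, c, h, rfl, Or.inr rfl⟩, fun hc => ?_⟩
        refine (hm.2 _ hd _ hc ?_).1 rfl
        intro hh
        exact h.ne (Finset.singleton_injective (congrArg Prod.snd hh))
      simp only [List.cons_append, List.isChain_cons_cons]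
      refine ⟨s1, ?_⟩
      generalize expand p ++ [{b}] = L at ih1 ih2
      cases L with
      | nil => simp at ih1
      | cons z L =>
        simp only [List.head?_cons, Option.some.injEq] at ih1
        subst ih1
        exact List.isChain_cons_cons.2 ⟨s2, ih2⟩

lemma expand_isCycleList (hm : IsMatching (GraphArc G) m) {a : V} {w : G.Walk a a}
    (hw : w.IsCycle) (hd : ∀ d ∈ w.darts, (({d.fst, d.snd} : Finset V), {d.fst}) ∈ m) :
    IsCycleList (MStep (GraphArc G) m) (expand w) := by
  have hn := expand_nodup_of_cycle hw
  obtain ⟨h1, h2⟩ := expand_chain hm w hd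
  have hne : {a} ∈ expand w := by
    rw [singleton_mem_expand, ← mem_support_iff' w hw.ne_nil]; simp
  generalize expand w = L at *
  cases L with
  | nil => simp at hne
  | cons x L =>
    simp only [List.cons_append, List.head?_cons, Option.some.injEq] at h1
    subst h1
    exact ⟨hn, h2⟩

lemma cycles_finite [Fintype V] (m : Finset (Finset V × Finset V)) :
    (cyclesOf (GraphArc G) m).Finite := by
  refine (List.finite_length_le (Finset V) (Fintype.card (Finset V))).subset ?_
  intro l hl
  exact ((isCycleList_iff _ _).1 hl).2.1.length_le_card

lemma exists_single {l : List (Finset V)} (hl : IsCycleList (MStep (GraphArc G) m) l) :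
    ∃ a, {a} ∈ l := by
  cases l with
  | nil => exact hl.elim
  | cons x t =>
    have hc : (x :: (t ++ [x])).IsChain (MStep (GraphArc G) m) := hl.2
    have : ∃ z ∈ x :: t, MStep (GraphArc G) m x z := by
      cases t with
      | nil => exact ⟨x, by simp, (List.isChain_cons_cons.1 hc).1⟩
      | cons z t => exact ⟨z, by simp, (List.isChain_cons_cons.1 hc).1⟩
    obtain ⟨z, hz, h⟩ := this
    rcases h with ⟨h, _⟩ | ⟨h, _⟩
    · obtain ⟨a, c, _, _, rfl⟩ := arc_form h
      exact ⟨a, hz⟩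
    · obtain ⟨a, c, _, _, rfl⟩ := arc_form h
      exact ⟨a, by simp⟩

lemma exists_walk {l : List (Finset V)} (hl : IsCycleList (MStep (GraphArc G) m) l) :
    ∃ (a : V) (w : G.Walk a a), w.IsCycle ∧ ∀ x ∈ w.support, {x} ∈ l := by
  obtain ⟨a, ha⟩ := exists_single hl
  obtain ⟨t, ht⟩ := exists_rotate ha
  have h := isCycleList_rotated ht hl
  obtain ⟨w, hw⟩ := walk_of_chain ({a} :: t) a a rfl h.2
  have hne : w ≠ Walk.nil := by
    rintro rfl
    simp [expand] at hw
  refine ⟨a, w, cycle_of_expand_nodup w hne (hw ▸ h.1), ?_⟩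
  intro x hx
  rw [ht.mem_iff, ← hw, singleton_mem_expand, ← mem_support_iff' w hne]
  exact hx

lemma upper [Fintype V] (hm : IsMatching (GraphArc G) m) :
    ∃ (v : Fin (numCycles (GraphArc G) m) → V) (w : ∀ i, G.Walk (v i) (v i)),
        (∀ i, (w i).IsCycle) ∧
        ∀ i j, i ≠ j → ∀ x : V, x ∈ (w i).support → x ∉ (w j).support := by
  have hfin := (cycles_finite (G := G) m).image (Quotient.mk (List.IsRotated.setoid (Finset V)))
  have : Finite (Quotient.mk (List.IsRotated.setoid (Finset V)) '' cyclesOf (GraphArc G) m) := hfin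
  let e := (Finite.equivFinOfCardEq (Nat.card_coe_set_eq
    (Quotient.mk (List.IsRotated.setoid (Finset V)) '' cyclesOf (GraphArc G) m))).symm
  have hrep : ∀ i, ∃ l, l ∈ cyclesOf (GraphArc G) m ∧
      Quotient.mk (List.IsRotated.setoid (Finset V)) l = (e i).1 := fun i => (e i).2
  choose l hl hq using hrep
  choose v w hc hs using fun i => exists_walk (hl i)
  refine ⟨v, w, hc, ?_⟩
  intro i j hij x hi hj
  apply hij
  have hr := rotated_of_common (step_det hm) (hl i) (hl j) (hs i x hi) (hs j x hj)
  apply e.injective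
  apply Subtype.ext
  rw [← hq i, ← hq j]
  exact Quotient.sound hr

lemma lower [Fintype V] {n : ℕ} (v : Fin n → V) (w : ∀ i, G.Walk (v i) (v i))
    (hc : ∀ i, (w i).IsCycle)
    (hdis : ∀ i j, i ≠ j → ∀ x : V, x ∈ (w i).support → x ∉ (w j).support) :
    ∃ m : Finset (Finset V × Finset V), IsMatching (GraphArc G) m ∧
      n ≤ numCycles (GraphArc G) m := by
  classical
  have hdis' : ∀ i j x, x ∈ (w i).support → x ∈ (w j).support → i = j := by
    intro i j x hi hj
    by_contra h
    exact hdis i j h x hi hj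
  let m : Finset (Finset V × Finset V) := Finset.univ.filter fun p =>
    ∃ i, ∃ d ∈ (w i).darts, p = ({d.fst, d.snd}, {d.fst})
  have hm : IsMatching (GraphArc G) m := by
    constructor
    · intro p hp
      obtain ⟨i, d, hd, rfl⟩ := (Finset.mem_filter.1 hp).2
      exact ⟨d.fst, d.snd, d.adj, rfl, Or.inl rfl⟩
    · intro p hp q hq hne
      obtain ⟨i, d, hd, rfl⟩ := (Finset.mem_filter.1 hp).2
      obtain ⟨j, d', hd', rfl⟩ := (Finset.mem_filter.1 hq).2
      have f1 := (w i).dart_fst_mem_support_of_mem_darts hd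
      refine ⟨?_, pair_ne_single _ _, (pair_ne_single _ _).symm, ?_⟩
      · intro h
        simp only at h
        have hmem : d.fst ∈ ({d'.fst, d'.snd} : Finset V) := h ▸ (by simp)
        have f2 : d.fst ∈ (w j).support := by
          simp only [Finset.mem_insert, Finset.mem_singleton] at hmem
          rcases hmem with h | h
          · rw [h]; exact (w j).dart_fst_mem_support_of_mem_darts hd'
          · rw [h]; exact (w j).dart_snd_mem_support_of_mem_darts hd'
        obtain rfl := hdis' i j _ f1 f2
        exact hne (by rw [cycle_edge_inj (hc i) hd hd' h])
      · intro h
        have h := Finset.singleton_injective h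
        obtain rfl := hdis' i j _ f1 (h ▸ (w j).dart_fst_mem_support_of_mem_darts hd')
        exact hne (by rw [cycle_fst_inj (hc i) hd hd' h])
  refine ⟨m, hm, ?_⟩
  have hfin := (cycles_finite (G := G) m).image (Quotient.mk (List.IsRotated.setoid (Finset V)))
  let f : Fin n → Quotient (List.IsRotated.setoid (Finset V)) := fun i =>
    Quotient.mk _ (expand (w i))
  have hf : Function.Injective f := by
    intro i j hij
    have hr : (expand (w i)).IsRotated (expand (w j)) := Quotient.exact hij
    have hi : v i ∈ (w i).support := by simp
    refine hdis' i j (v i) hi ?_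
    rw [mem_support_iff' _ (hc j).ne_nil, ← singleton_mem_expand, ← hr.mem_iff,
      singleton_mem_expand, ← mem_support_iff' _ (hc i).ne_nil]
    exact hi
  have hsub : Set.range f ⊆
      Quotient.mk (List.IsRotated.setoid (Finset V)) '' cyclesOf (GraphArc G) m := by
    rintro _ ⟨i, rfl⟩
    refine ⟨expand (w i), expand_isCycleList hm (hc i) ?_, rfl⟩
    intro d hd
    exact Finset.mem_filter.2 ⟨Finset.mem_univ _, i, d, hd, rfl⟩
  calc n = (Set.range f).ncard := by
        rw [← Set.image_univ, Set.ncard_image_of_injective _ hf, Set.ncard_univ, Nat.card_fin]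
    _ ≤ _ := Set.ncard_le_ncard hsub hfin

end EtaAux

/-- for a finite simple graph `G`, `η(G)` — the maximum over matchings
`m` on `F(G)` of the number `J(m)` of induced oriented cycles — equals the maximum
number of pairwise vertex-disjoint cycles in `G`. -/
theorem eta_eq_max_vertex_disjoint_cycles {V : Type*} [Fintype V] [DecidableEq V]
    (G : SimpleGraph V) :
    sSup {n : ℕ | ∃ m : Finset (Finset V × Finset V),
        IsMatching (GraphArc G) m ∧ numCycles (GraphArc G) m = n} =
    sSup {n : ℕ | ∃ (v : Fin n → V) (w : ∀ i, G.Walk (v i) (v i)),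
        (∀ i, (w i).IsCycle) ∧
        ∀ i j, i ≠ j → ∀ x : V, x ∈ (w i).support → x ∉ (w j).support} := by
  have hb2 : BddAbove {n : ℕ | ∃ (v : Fin n → V) (w : ∀ i, G.Walk (v i) (v i)),
        (∀ i, (w i).IsCycle) ∧
        ∀ i j, i ≠ j → ∀ x : V, x ∈ (w i).support → x ∉ (w j).support} := by
    refine ⟨Fintype.card V, ?_⟩
    rintro n ⟨v, w, _, hd⟩
    have hv : Function.Injective v := by
      intro i j hij
      by_contra hne
      exact hd i j hne (v i) (by simp) (by rw [hij]; simp)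
    simpa using Fintype.card_le_of_injective v hv
  apply le_antisymm
  · refine csSup_le ⟨_, ∅, ?_, rfl⟩ ?_
    · simp [IsMatching]
    · rintro n ⟨m, hm, rfl⟩
      exact le_csSup hb2 (EtaAux.upper hm)
  · refine csSup_le ⟨0, Fin.elim0, fun i => i.elim0, fun i => i.elim0, fun i => i.elim0⟩ ?_
    rintro n ⟨v, w, hc, hd⟩
    obtain ⟨m, hm, hn⟩ := EtaAux.lower v w hc hd
    refine hn.trans (le_csSup ?_ ⟨m, hm, rfl⟩)
    refine hb2.mono ?_
    rintro _ ⟨m, hm, rfl⟩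
    exact EtaAux.upper hm
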